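/- arXiv:1510.07542 — 3 statements merged into one kernel-verified Lean document; each statement's English description precedes it below -/
import Mathlib

section
/- Let n ≥ 1, let a₁, …, a_{n+1} > 0 and k > 1, and set h(x,z) = −Σ_{i=1}^n xᵢ²/aᵢ² + z²/a_{n+1}². For every x̄ ∈ ℝⁿ, let z̄ = a_{n+1}√(k² + Σ_{i=1}^n x̄ᵢ²/aᵢ²) and consider the hyperplane tangent at (x̄, z̄) to the upper sheet of the hyperboloid h(x,z) = k², namely z = (a_{n+1}²/z̄)(k² + Σ_{i=1}^n xᵢx̄ᵢ/aᵢ²). The compact set it cuts off from the upper sheet of h(x,z) = 1 has volume independent of x̄: the (n+1)-dimensional Lebesgue measure of {(x,z) ∈ ℝⁿ × ℝ : a_{n+1}√(1 + Σ_{i=1}^n xᵢ²/aᵢ²) ≤ z ≤ (a_{n+1}²/z̄)(k² + Σ_{i=1}^n xᵢx̄ᵢ/aᵢ²)} equals a₁⋯a_{n+1} · (π^{n/2} / Γ(n/2 + 1)) · ∫₁^{k} (ζ² − 1)^{n/2} dζ. -/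
open MeasureTheory

/-- The solid cut off from the upper sheet of the unit hyperboloid by the hyperplane `t = k`. -/
def hyperboloidCap (n : ℕ) (k : ℝ) : Set (EuclideanSpace ℝ (Fin n) × ℝ) :=
  {w | Real.sqrt (1 + ‖w.1‖ ^ 2) ≤ w.2 ∧ w.2 ≤ k}

lemma measurableSet_hyperboloidCap (n : ℕ) (k : ℝ) : MeasurableSet (hyperboloidCap n k) := by
  refine ((isClosed_le (f := fun w : EuclideanSpace ℝ (Fin n) × ℝ => Real.sqrt (1 + ‖w.1‖ ^ 2))
    ?_ continuous_snd).inter (isClosed_le continuous_snd continuous_const)).measurableSet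
  fun_prop

lemma sqrt_pow_eq_rpow_half (n : ℕ) {x : ℝ} (hx : 0 ≤ x) :
    Real.sqrt x ^ n = x ^ ((n : ℝ) / 2) := by
  rw [Real.sqrt_eq_rpow, ← Real.rpow_natCast, ← Real.rpow_mul hx]
  ring_nf

lemma volume_hyperboloidCap_slice {n : ℕ} (hn : 1 ≤ n) (k t : ℝ) :
    volume ((fun y => (y, t)) ⁻¹' hyperboloidCap n k) =
      (Set.Icc 1 k).indicator (fun ζ => ENNReal.ofReal
        (Real.pi ^ ((n : ℝ) / 2) / Real.Gamma ((n : ℝ) / 2 + 1) *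
          (ζ ^ 2 - 1) ^ ((n : ℝ) / 2))) t := by
  have : Nonempty (Fin n) := ⟨⟨0, hn⟩⟩
  by_cases ht : t ∈ Set.Icc 1 k
  · have h0 : 0 ≤ t ^ 2 - 1 := by nlinarith [ht.1]
    have hball : (fun y => (y, t)) ⁻¹' hyperboloidCap n k =
        Metric.closedBall (0 : EuclideanSpace ℝ (Fin n)) (Real.sqrt (t ^ 2 - 1)) := by
      ext y
      simp only [hyperboloidCap, Set.mem_preimage, Set.mem_ofPred_eq, mem_closedBall_zero_iff]
      rw [Real.sqrt_le_left (by linarith [ht.1]), Real.le_sqrt (norm_nonneg _) h0]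
      exact ⟨fun h => by linarith [h.1], fun h => ⟨by linarith, ht.2⟩⟩
    rw [hball, EuclideanSpace.volume_closedBall, Set.indicator_of_mem ht, Fintype.card_fin,
      ← ENNReal.ofReal_pow (Real.sqrt_nonneg _), ← ENNReal.ofReal_mul (by positivity),
      sqrt_pow_eq_rpow_half n h0, sqrt_pow_eq_rpow_half n Real.pi_pos.le, mul_comm]
  · rw [Set.indicator_of_notMem ht]
    convert measure_empty (μ := (volume : Measure (EuclideanSpace ℝ (Fin n))))
    ext y
    simp only [hyperboloidCap, Set.mem_preimage, Set.mem_ofPred_eq, Set.mem_empty_iff_false,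
      iff_false]
    rintro ⟨h1, h2⟩
    refine ht ⟨le_trans ?_ h1, h2⟩
    rw [Real.one_le_sqrt]
    linarith [sq_nonneg ‖y‖]

lemma volume_hyperboloidCap {n : ℕ} (hn : 1 ≤ n) {k : ℝ} (hk : 1 ≤ k) :
    volume (hyperboloidCap n k) = ENNReal.ofReal
      (Real.pi ^ ((n : ℝ) / 2) / Real.Gamma ((n : ℝ) / 2 + 1) *
        ∫ ζ in (1 : ℝ)..k, (ζ ^ 2 - 1) ^ ((n : ℝ) / 2)) := by
  have hc : Continuous fun ζ : ℝ => (ζ ^ 2 - 1) ^ ((n : ℝ) / 2) :=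
    Continuous.rpow_const (by fun_prop) fun _ => Or.inr (by positivity)
  have hΓ : 0 ≤ Real.Gamma ((n : ℝ) / 2 + 1) := (Real.Gamma_pos_of_pos (by positivity)).le
  rw [Measure.volume_eq_prod, Measure.prod_apply_symm (measurableSet_hyperboloidCap n k)]
  simp_rw [volume_hyperboloidCap_slice hn]
  rw [lintegral_indicator measurableSet_Icc, ← ofReal_integral_eq_lintegral_ofReal,
    integral_const_mul, intervalIntegral.integral_of_le hk, integral_Icc_eq_integral_Ioc]
  · exact ((hc.const_mul _).continuousOn).integrableOn_Icc
  · refine (ae_restrict_mem measurableSet_Icc).mono fun ζ hζ => ?_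
    have h0 : 0 ≤ ζ ^ 2 - 1 := by nlinarith [hζ.1]
    exact mul_nonneg (div_nonneg (by positivity) hΓ) (Real.rpow_nonneg h0 _)

section Boost

variable {E : Type*} [NormedAddCommGroup E] [InnerProductSpace ℝ E]

/-- The Lorentz boost of `E × ℝ` with velocity parameters `(q, γ)`, composed with the reflection
of `E` through the origin. -/
noncomputable def reflectedBoost (q : E) (γ : ℝ) : E × ℝ →ₗ[ℝ] E × ℝ where
  toFun w := (-w.1 + (w.2 - inner ℝ q w.1 / (1 + γ)) • q, γ * w.2 - inner ℝ q w.1)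
  map_add' v w := by
    ext
    · simp only [Prod.fst_add, Prod.snd_add, inner_add_right, add_div]
      module
    · simp only [Prod.fst_add, Prod.snd_add, inner_add_right]
      ring
  map_smul' c w := by
    ext
    · simp only [Prod.smul_fst, Prod.smul_snd, inner_smul_right, smul_eq_mul, RingHom.id_apply,
        mul_div_assoc]
      module
    · simp only [Prod.smul_fst, Prod.smul_snd, inner_smul_right, smul_eq_mul, RingHom.id_apply]
      ring

lemma reflectedBoost_apply (q : E) (γ : ℝ) (w : E × ℝ) :
    reflectedBoost q γ w =
      (-w.1 + (w.2 - inner ℝ q w.1 / (1 + γ)) • q, γ * w.2 - inner ℝ q w.1) := rfl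

variable {q : E} {γ : ℝ}

lemma reflectedBoost_reflectedBoost (hγ : 0 ≤ γ) (h : γ ^ 2 = 1 + ‖q‖ ^ 2) (w : E × ℝ) :
    reflectedBoost q γ (reflectedBoost q γ w) = w := by
  have hq : ‖q‖ ^ 2 = γ ^ 2 - 1 := by linarith
  have h1 : 1 + γ ≠ 0 := by positivity
  obtain ⟨y, t⟩ := w
  simp only [reflectedBoost_apply, inner_add_right, inner_neg_right, inner_smul_right,
    real_inner_self_eq_norm_sq, hq]
  generalize (inner ℝ q y : ℝ) = c
  ext
  · have : γ * t - c - (-c + (t - c / (1 + γ)) * (γ ^ 2 - 1)) / (1 + γ) = t - c / (1 + γ) := by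
      field_simp
      ring
    simp only [this]
    module
  · simp only
    field_simp
    ring

lemma abs_det_reflectedBoost (hγ : 0 ≤ γ) (h : γ ^ 2 = 1 + ‖q‖ ^ 2) :
    |LinearMap.det (reflectedBoost q γ)| = 1 := by
  have hcomp : reflectedBoost q γ ∘ₗ reflectedBoost q γ = LinearMap.id :=
    LinearMap.ext fun w => reflectedBoost_reflectedBoost hγ h w
  have hdet := congrArg LinearMap.det hcomp
  rw [LinearMap.det_comp, LinearMap.det_id] at hdet
  rcases mul_self_eq_one_iff.mp hdet with h' | h' <;> simp [h']

lemma reflectedBoost_form (hγ : 0 ≤ γ) (h : γ ^ 2 = 1 + ‖q‖ ^ 2) (w : E × ℝ) :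
    (reflectedBoost q γ w).2 ^ 2 - ‖(reflectedBoost q γ w).1‖ ^ 2 = w.2 ^ 2 - ‖w.1‖ ^ 2 := by
  have hq : ‖q‖ ^ 2 = γ ^ 2 - 1 := by linarith
  have h1 : 1 + γ ≠ 0 := by positivity
  obtain ⟨y, t⟩ := w
  simp only [reflectedBoost_apply]
  rw [norm_add_sq_real, norm_smul, mul_pow, norm_neg, inner_neg_left, inner_smul_right,
    real_inner_comm, hq, Real.norm_eq_abs, sq_abs]
  generalize (inner ℝ q y : ℝ) = c
  field_simp
  ring

lemma sqrt_le_reflectedBoost (hγ : 0 ≤ γ) (h : γ ^ 2 = 1 + ‖q‖ ^ 2) {w : E × ℝ}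
    (hw : Real.sqrt (1 + ‖w.1‖ ^ 2) ≤ w.2) :
    Real.sqrt (1 + ‖(reflectedBoost q γ w).1‖ ^ 2) ≤ (reflectedBoost q γ w).2 := by
  obtain ⟨ht, hw'⟩ := Real.sqrt_le_iff.mp hw
  refine Real.sqrt_le_iff.mpr ⟨?_, by linarith [reflectedBoost_form hγ h w]⟩
  have hqγ : ‖q‖ ≤ γ := abs_le_of_sq_le_sq' (by linarith) hγ |>.2
  have hyt : ‖w.1‖ ≤ w.2 := abs_le_of_sq_le_sq' (by linarith) ht |>.2
  rw [reflectedBoost_apply, sub_nonneg]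
  exact (real_inner_le_norm _ _).trans (mul_le_mul hqγ hyt (norm_nonneg _) hγ)

lemma sqrt_le_reflectedBoost_iff (hγ : 0 ≤ γ) (h : γ ^ 2 = 1 + ‖q‖ ^ 2) (w : E × ℝ) :
    Real.sqrt (1 + ‖(reflectedBoost q γ w).1‖ ^ 2) ≤ (reflectedBoost q γ w).2 ↔
      Real.sqrt (1 + ‖w.1‖ ^ 2) ≤ w.2 := by
  refine ⟨fun hw => ?_, sqrt_le_reflectedBoost hγ h⟩
  simpa only [reflectedBoost_reflectedBoost hγ h] using sqrt_le_reflectedBoost hγ h hw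

end Boost

/-- The linear map dividing the coordinates of `x` by `a i` and `z` by `b`. -/
noncomputable def axisScaling {n : ℕ} (a : Fin n → ℝ) (b : ℝ) :
    EuclideanSpace ℝ (Fin n) × ℝ →ₗ[ℝ] EuclideanSpace ℝ (Fin n) × ℝ :=
  (Matrix.toLin (EuclideanSpace.basisFun (Fin n) ℝ).toBasis
    (EuclideanSpace.basisFun (Fin n) ℝ).toBasis (Matrix.diagonal fun i => (a i)⁻¹)).prodMap
    (b⁻¹ • LinearMap.id)

lemma det_axisScaling {n : ℕ} (a : Fin n → ℝ) (b : ℝ) :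
    LinearMap.det (axisScaling a b) = ((∏ i, a i) * b)⁻¹ := by
  rw [axisScaling, LinearMap.det_prodMap, LinearMap.det_toLin, Matrix.det_diagonal,
    LinearMap.det_smul, LinearMap.det_id]
  simp [mul_comm]

lemma axisScaling_fst_apply {n : ℕ} (a : Fin n → ℝ) (b : ℝ) (w : EuclideanSpace ℝ (Fin n) × ℝ)
    (i : Fin n) : (axisScaling a b w).1 i = w.1 i / a i := by
  simp [axisScaling, ← Matrix.toEuclideanLin_eq_toLin_orthonormal, Matrix.toLpLin_apply, Matrix.mulVec_diagonal, div_eq_inv_mul]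

lemma axisScaling_snd {n : ℕ} (a : Fin n → ℝ) (b : ℝ) (w : EuclideanSpace ℝ (Fin n) × ℝ) :
    (axisScaling a b w).2 = w.2 / b := by
  simp [axisScaling, div_eq_inv_mul]

theorem stmt_8 (n : ℕ) (hn : 1 ≤ n) (a : Fin n → ℝ) (b : ℝ)
    (ha : ∀ i, a i > 0) (hb : b > 0) (k : ℝ) (hk : k > 1)
    (xb : EuclideanSpace ℝ (Fin n)) (zb : ℝ)
    (hzb : zb = b * Real.sqrt (k ^ 2 + ∑ i, (xb i) ^ 2 / (a i) ^ 2)) :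
    volume {w : EuclideanSpace ℝ (Fin n) × ℝ |
        b * Real.sqrt (1 + ∑ i, (w.1 i) ^ 2 / (a i) ^ 2) ≤ w.2 ∧
        w.2 ≤ (b ^ 2 / zb) * (k ^ 2 + ∑ i, w.1 i * xb i / (a i) ^ 2)} =
      ENNReal.ofReal ((∏ i, a i) * b *
        (Real.pi ^ ((n : ℝ) / 2) / Real.Gamma ((n : ℝ) / 2 + 1)) *
        ∫ ζ in (1 : ℝ)..k, (ζ ^ 2 - 1) ^ ((n : ℝ) / 2)) := by
  have hk0 : 0 < k := by linarith
  have hprod : 0 < (∏ i, a i) * b := mul_pos (Finset.prod_pos fun i _ => ha i) hb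
  set S := ∑ i, (xb i) ^ 2 / (a i) ^ 2 with hS
  have hS0 : 0 ≤ S := Finset.sum_nonneg fun i _ => by positivity
  set s := Real.sqrt (k ^ 2 + S) with hs
  have hs0 : 0 < s := Real.sqrt_pos.mpr (by positivity)
  have hs2 : s ^ 2 = k ^ 2 + S := Real.sq_sqrt (by positivity)
  set q : EuclideanSpace ℝ (Fin n) := WithLp.toLp 2 fun i => xb i / a i / k with hq
  have hqn : ‖q‖ ^ 2 = S / k ^ 2 := by
    rw [EuclideanSpace.real_norm_sq_eq, hS, Finset.sum_div]
    simp [hq, div_pow]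
  have hγ0 : 0 ≤ s / k := by positivity
  have hγ : (s / k) ^ 2 = 1 + ‖q‖ ^ 2 := by
    rw [hqn, div_pow, hs2]
    field_simp
  have hset : {w : EuclideanSpace ℝ (Fin n) × ℝ |
      b * Real.sqrt (1 + ∑ i, (w.1 i) ^ 2 / (a i) ^ 2) ≤ w.2 ∧
      w.2 ≤ (b ^ 2 / zb) * (k ^ 2 + ∑ i, w.1 i * xb i / (a i) ^ 2)} =
      axisScaling a b ⁻¹' (reflectedBoost q (s / k) ⁻¹' hyperboloidCap n k) := by
    ext w
    have hnorm : ‖(axisScaling a b w).1‖ ^ 2 = ∑ i, (w.1 i) ^ 2 / (a i) ^ 2 := by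
      simp [EuclideanSpace.real_norm_sq_eq, axisScaling_fst_apply, div_pow]
    have hinner : inner ℝ q (axisScaling a b w).1 = (∑ i, w.1 i * xb i / (a i) ^ 2) / k := by
      rw [PiLp.inner_apply, Finset.sum_div]
      refine Finset.sum_congr rfl fun i _ => ?_
      have := (ha i).ne'
      simp only [axisScaling_fst_apply, hq, RCLike.inner_apply, conj_trivial]
      field_simp
    simp only [Set.mem_preimage, hyperboloidCap, Set.mem_ofPred_eq]
    rw [sqrt_le_reflectedBoost_iff hγ0 hγ, hnorm, axisScaling_snd, le_div_iff₀' hb]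
    refine and_congr Iff.rfl ?_
    rw [reflectedBoost_apply, hinner, axisScaling_snd, hzb]
    generalize (∑ i, w.1 i * xb i / (a i) ^ 2) = c
    have e1 : b ^ 2 / (b * s) * (k ^ 2 + c) = (b * (k ^ 2 + c)) / s := by field_simp
    have e2 : s / k * (w.2 / b) - c / k = (w.2 * s / b - c) / k := by field_simp
    rw [e1, e2, le_div_iff₀ hs0, div_le_iff₀ hk0, sub_le_iff_le_add, div_le_iff₀ hb]
    ring_nf
  have hdet1 := abs_det_reflectedBoost hγ0 hγ
  have hdet2 := det_axisScaling a b
  have : (volume : Measure (EuclideanSpace ℝ (Fin n) × ℝ)).IsAddHaarMeasure :=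
    Measure.prod.instIsAddHaarMeasure _ _
  rw [hset, Measure.addHaar_preimage_linearMap _ (by rw [hdet2]; positivity),
    Measure.addHaar_preimage_linearMap _ (by intro h0; simp [h0] at hdet1), hdet2, abs_inv,
    abs_inv, abs_inv, inv_inv, hdet1, abs_of_pos hprod, volume_hyperboloidCap hn hk.le, inv_one,
    ENNReal.ofReal_one, one_mul, ← ENNReal.ofReal_mul hprod.le, mul_assoc _ (_ / _)]
end

section
/- Let n ≥ 1 and ε > 0, let p̄ ∈ ℝⁿ and (x̄, z̄) ∈ ℝⁿ × ℝ, and set d = z̄ − ⟨p̄, x̄⟩ and q = 1 − |p̄|². Suppose q > 0, d ≥ 0, and 1 + εd ≥ √(1 + ε²)·√(1 − q), and set ζ_P = d/√q. Then the volume of the compact set S_ε = {(x,z) ∈ ℝⁿ × ℝ : z ≥ −1/ε, |x|² ≤ 1 + z², z ≤ z̄ + ⟨p̄, x − x̄⟩}, cut off by the hyperplane z − z̄ = ⟨p̄, x − x̄⟩ from the truncated solid one-sheeted hyperboloid H_ε = {(x,z) : z ≥ −1/ε, |x|² ≤ 1 + z²}, equals (π^{n/2} / Γ(n/2 + 1))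 · ∫_{−1/ε}^{ζ_P} (1 + ζ²)^{n/2} dζ. -/
open MeasureTheory
open scoped RealInnerProductSpace

section LorentzInvolution

variable {E : Type*} [NormedAddCommGroup E] [InnerProductSpace ℝ E]

/-- The Lorentz boost of velocity `p` composed with `x ↦ -x`; it is an involution when
`γ ^ 2 * (1 - ‖p‖ ^ 2) = 1` and `k * (γ + 1) = γ ^ 2`. -/
def lorentzInvolution (p : E) (γ k : ℝ) : E × ℝ →ₗ[ℝ] E × ℝ where
  toFun w := (-w.1 + (γ * w.2 - k * ⟪p, w.1⟫) • p, γ * (w.2 - ⟪p, w.1⟫))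
  map_add' v w := by
    refine Prod.ext ?_ ?_
    · simp only [Prod.fst_add, Prod.snd_add, inner_add_right]
      module
    · simp only [Prod.fst_add, Prod.snd_add, inner_add_right]
      ring
  map_smul' c w := by
    refine Prod.ext ?_ ?_
    · simp only [Prod.smul_fst, Prod.smul_snd, real_inner_smul_right, RingHom.id_apply,
        smul_eq_mul]
      module
    · simp only [Prod.smul_fst, Prod.smul_snd, real_inner_smul_right, RingHom.id_apply,
        smul_eq_mul]
      ring

lemma lorentzInvolution_apply (p : E) (γ k : ℝ) (w : E × ℝ) :
    lorentzInvolution p γ k w =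
      (-w.1 + (γ * w.2 - k * ⟪p, w.1⟫) • p, γ * (w.2 - ⟪p, w.1⟫)) := rfl

variable {p : E} {γ k : ℝ}

lemma lorentzInvolution_height (hγ : γ ^ 2 * ‖p‖ ^ 2 = γ ^ 2 - 1)
    (hk : k * ‖p‖ ^ 2 = γ - 1) (w : E × ℝ) :
    γ * ((lorentzInvolution p γ k w).2 - ⟪p, (lorentzInvolution p γ k w).1⟫) = w.2 := by
  simp only [lorentzInvolution_apply, inner_add_right, inner_neg_right, real_inner_smul_right,
    real_inner_self_eq_norm_sq]
  linear_combination (-w.2) * hγ + γ * ⟪p, w.1⟫ * hk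

lemma lorentzInvolution_involutive (hγ : γ ^ 2 * ‖p‖ ^ 2 = γ ^ 2 - 1)
    (hk : k * ‖p‖ ^ 2 = γ - 1) (hγk : k * (γ + 1) = γ ^ 2) (w : E × ℝ) :
    lorentzInvolution p γ k (lorentzInvolution p γ k w) = w := by
  refine Prod.ext ?_ (lorentzInvolution_height hγ hk w)
  have key : γ * (γ * (w.2 - ⟪p, w.1⟫)) -
      k * (-⟪p, w.1⟫ + (γ * w.2 - k * ⟪p, w.1⟫) * ‖p‖ ^ 2) =
        γ * w.2 - k * ⟪p, w.1⟫ := by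
    linear_combination (k * ⟪p, w.1⟫ - γ * w.2) * hk + ⟪p, w.1⟫ * hγk
  simp only [lorentzInvolution_apply, inner_add_right, inner_neg_right, real_inner_smul_right,
    real_inner_self_eq_norm_sq, key]
  module

lemma lorentzInvolution_quadraticForm (hγ : γ ^ 2 * ‖p‖ ^ 2 = γ ^ 2 - 1)
    (hk : k * ‖p‖ ^ 2 = γ - 1) (hγk : k * (γ + 1) = γ ^ 2) (w : E × ℝ) :
    ‖(lorentzInvolution p γ k w).1‖ ^ 2 - (lorentzInvolution p γ k w).2 ^ 2 =
      ‖w.1‖ ^ 2 - w.2 ^ 2 := by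
  simp only [lorentzInvolution_apply]
  rw [norm_add_sq_real, norm_neg, norm_smul, mul_pow, inner_neg_left, real_inner_smul_right,
    real_inner_comm p w.1, Real.norm_eq_abs, sq_abs]
  linear_combination (k * ⟪p, w.1⟫ ^ 2 - 2 * γ * ⟪p, w.1⟫ * w.2) * hk + w.2 ^ 2 * hγ +
    ⟪p, w.1⟫ ^ 2 * hγk

lemma abs_det_lorentzInvolution (hγ : γ ^ 2 * ‖p‖ ^ 2 = γ ^ 2 - 1)
    (hk : k * ‖p‖ ^ 2 = γ - 1) (hγk : k * (γ + 1) = γ ^ 2) :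
    |LinearMap.det (lorentzInvolution p γ k)| = 1 := by
  have hcomp : lorentzInvolution p γ k ∘ₗ lorentzInvolution p γ k = LinearMap.id :=
    LinearMap.ext (lorentzInvolution_involutive hγ hk hγk)
  have hdet := LinearMap.det_comp (lorentzInvolution p γ k) (lorentzInvolution p γ k)
  rw [hcomp, LinearMap.det_id] at hdet
  rcases mul_self_eq_one_iff.1 hdet.symm with h | h <;> simp [h]

end LorentzInvolution

/-- The region of the solid hyperboloid above height `c` and below the tilted hyperplane has the
same volume as the region below height `c` and above the tilted hyperplane. -/
lemma volume_above_lower_eq_below_upper {n : ℕ} (p : EuclideanSpace ℝ (Fin n)) {γ : ℝ}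
    (hγ0 : 0 < γ) (hγ : γ ^ 2 * ‖p‖ ^ 2 = γ ^ 2 - 1) (c : ℝ) :
    volume {w : EuclideanSpace ℝ (Fin n) × ℝ |
        ‖w.1‖ ^ 2 ≤ 1 + w.2 ^ 2 ∧ c < w.2 ∧ γ * (w.2 - ⟪p, w.1⟫) ≤ c} =
      volume {w : EuclideanSpace ℝ (Fin n) × ℝ |
        ‖w.1‖ ^ 2 ≤ 1 + w.2 ^ 2 ∧ w.2 ≤ c ∧ c < γ * (w.2 - ⟪p, w.1⟫)} := by
  obtain ⟨k, hγk⟩ : ∃ k : ℝ, k * (γ + 1) = γ ^ 2 := ⟨γ ^ 2 / (γ + 1), by field_simp⟩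
  have hk : k * ‖p‖ ^ 2 = γ - 1 := by
    have : (γ + 1) * (k * ‖p‖ ^ 2) = (γ + 1) * (γ - 1) := by
      linear_combination ‖p‖ ^ 2 * hγk + hγ
    exact mul_left_cancel₀ (by positivity) this
  have hdet := abs_det_lorentzInvolution hγ hk hγk
  have : (volume : Measure (EuclideanSpace ℝ (Fin n) × ℝ)).IsAddHaarMeasure :=
    inferInstanceAs ((volume : Measure (EuclideanSpace ℝ (Fin n))).prod
      (volume : Measure ℝ)).IsAddHaarMeasure
  have hvol := Measure.addHaar_preimage_linearMap
    (volume : Measure (EuclideanSpace ℝ (Fin n) × ℝ)) (f := lorentzInvolution p γ k)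
    (by intro h; simp [h] at hdet)
    {w | ‖w.1‖ ^ 2 ≤ 1 + w.2 ^ 2 ∧ c < w.2 ∧ γ * (w.2 - ⟪p, w.1⟫) ≤ c}
  rw [abs_inv, hdet, inv_one, ENNReal.ofReal_one, one_mul] at hvol
  rw [← hvol]
  congr 1
  ext w
  have hform := lorentzInvolution_quadraticForm hγ hk hγk w
  have hheight := lorentzInvolution_height hγ hk w
  simp only [Set.mem_preimage, Set.mem_ofPred_eq, hheight]
  rw [show (lorentzInvolution p γ k w).2 = γ * (w.2 - ⟪p, w.1⟫) from rfl] at hform ⊢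
  constructor
  · rintro ⟨h1, h2, h3⟩
    exact ⟨by linarith, h3, h2⟩
  · rintro ⟨h1, h2, h3⟩
    exact ⟨by linarith, h3, h2⟩

lemma volume_hyperboloid_slab (n : ℕ) (hn : 1 ≤ n) {a b : ℝ} (hab : a ≤ b) :
    volume {w : EuclideanSpace ℝ (Fin n) × ℝ |
        ‖w.1‖ ^ 2 ≤ 1 + w.2 ^ 2 ∧ a ≤ w.2 ∧ w.2 ≤ b} =
      ENNReal.ofReal (Real.pi ^ ((n : ℝ) / 2) / Real.Gamma ((n : ℝ) / 2 + 1) *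
        ∫ ζ in a..b, (1 + ζ ^ 2) ^ ((n : ℝ) / 2)) := by
  have : Nonempty (Fin n) := ⟨⟨0, hn⟩⟩
  have hC : 0 ≤ Real.pi ^ ((n : ℝ) / 2) / Real.Gamma ((n : ℝ) / 2 + 1) := by
    have := Real.pi_pos
    have := Real.Gamma_pos_of_pos (show (0 : ℝ) < (n : ℝ) / 2 + 1 by positivity)
    positivity
  have hmeas : MeasurableSet {w : EuclideanSpace ℝ (Fin n) × ℝ |
      ‖w.1‖ ^ 2 ≤ 1 + w.2 ^ 2 ∧ a ≤ w.2 ∧ w.2 ≤ b} := by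
    refine MeasurableSet.inter
      (s₁ := {w : EuclideanSpace ℝ (Fin n) × ℝ | ‖w.1‖ ^ 2 ≤ 1 + w.2 ^ 2}) ?_ ?_
    · exact measurableSet_le (by fun_prop) (by fun_prop)
    · exact measurable_snd measurableSet_Icc
  have hcont : Continuous fun ζ : ℝ => (1 + ζ ^ 2) ^ ((n : ℝ) / 2) :=
    (by fun_prop : Continuous fun ζ : ℝ => 1 + ζ ^ 2).rpow_const
      fun ζ => Or.inl (by positivity)
  have hpow : ∀ t : ℝ, 0 ≤ t → √t ^ n = t ^ ((n : ℝ) / 2) := fun t ht => by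
    rw [Real.sqrt_eq_rpow, ← Real.rpow_natCast, ← Real.rpow_mul ht]
    congr 1
    ring
  rw [Measure.volume_eq_prod, Measure.prod_apply_symm hmeas]
  have hslice : ∀ z : ℝ, volume ((fun x : EuclideanSpace ℝ (Fin n) => (x, z)) ⁻¹'
      {w | ‖w.1‖ ^ 2 ≤ 1 + w.2 ^ 2 ∧ a ≤ w.2 ∧ w.2 ≤ b}) =
      (Set.Icc a b).indicator (fun z => ENNReal.ofReal
        (Real.pi ^ ((n : ℝ) / 2) / Real.Gamma ((n : ℝ) / 2 + 1) *
          (1 + z ^ 2) ^ ((n : ℝ) / 2))) z := by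
    intro z
    by_cases hz : z ∈ Set.Icc a b
    · rw [Set.indicator_of_mem hz]
      have : (fun x : EuclideanSpace ℝ (Fin n) => (x, z)) ⁻¹'
          {w | ‖w.1‖ ^ 2 ≤ 1 + w.2 ^ 2 ∧ a ≤ w.2 ∧ w.2 ≤ b} =
          Metric.closedBall 0 √(1 + z ^ 2) := by
        ext x
        simp only [Set.mem_preimage, Set.mem_ofPred_eq, mem_closedBall_zero_iff]
        rw [Real.le_sqrt (norm_nonneg x) (by positivity)]
        exact and_iff_left hz
      rw [this, EuclideanSpace.volume_closedBall, Fintype.card_fin,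
        ← ENNReal.ofReal_pow (Real.sqrt_nonneg _), ← ENNReal.ofReal_mul (by positivity),
        hpow _ (by positivity), hpow _ Real.pi_pos.le, mul_comm]
    · rw [Set.indicator_of_notMem hz]
      convert measure_empty (μ := (volume : Measure (EuclideanSpace ℝ (Fin n))))
      ext x
      simp only [Set.mem_preimage, Set.mem_ofPred_eq, Set.mem_empty_iff_false, iff_false]
      exact fun h => hz h.2
  simp_rw [hslice]
  rw [lintegral_indicator measurableSet_Icc, ← intervalIntegral.integral_const_mul,
    intervalIntegral.integral_of_le hab, ← integral_Icc_eq_integral_Ioc,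
    ofReal_integral_eq_lintegral_ofReal]
  · exact (continuous_const.mul hcont).integrableOn_Icc
  · exact Filter.Eventually.of_forall fun z => mul_nonneg hC (by positivity)

/-- The part of the solid hyperboloid below height `-a` lies below the tilted hyperplane as soon
as its boundary slice does. -/
lemma sub_inner_le_of_lt_neg {E : Type*} [NormedAddCommGroup E] [InnerProductSpace ℝ E]
    {p x : E} {a d z : ℝ} (hp : ‖p‖ ≤ 1) (ha : 0 ≤ a) (hd : ‖p‖ * √(1 + a ^ 2) ≤ a + d)
    (hx : ‖x‖ ^ 2 ≤ 1 + z ^ 2) (hz : z < -a) : z - ⟪p, x⟫ ≤ d := by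
  have hsq := Real.sq_sqrt (show 0 ≤ 1 + a ^ 2 by positivity)
  have hsqa : a ≤ √(1 + a ^ 2) := Real.le_sqrt_of_sq_le (by linarith)
  have hx' : ‖x‖ ≤ √(1 + a ^ 2) + (-z - a) := by
    refine abs_le_of_sq_le_sq' ?_ (by linarith) |>.2
    nlinarith [mul_nonneg (sub_nonneg.2 hsqa) (show 0 ≤ -z - a by linarith)]
  have hinner := (abs_le.1 (abs_real_inner_le_norm p x)).1
  have := mul_le_mul_of_nonneg_left hx' (norm_nonneg p)
  nlinarith [mul_le_mul_of_nonneg_right hp (show 0 ≤ -z - a by linarith)]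

theorem stmt_10 (n : ℕ) (hn : 1 ≤ n) (ε : ℝ) (hε : ε > 0)
    (pb xb : EuclideanSpace ℝ (Fin n)) (zb : ℝ)
    (d q : ℝ) (hd : d = zb - ⟪pb, xb⟫) (hq : q = 1 - ‖pb‖ ^ 2)
    (hq0 : q > 0) (hd0 : d ≥ 0)
    (hεd : 1 + ε * d ≥ Real.sqrt (1 + ε ^ 2) * Real.sqrt (1 - q)) :
    volume {w : EuclideanSpace ℝ (Fin n) × ℝ |
        -1 / ε ≤ w.2 ∧ ‖w.1‖ ^ 2 ≤ 1 + w.2 ^ 2 ∧ w.2 ≤ zb + ⟪pb, w.1 - xb⟫} =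
      ENNReal.ofReal (Real.pi ^ ((n : ℝ) / 2) / Real.Gamma ((n : ℝ) / 2 + 1) *
        ∫ ζ in (-1 / ε)..(d / Real.sqrt q), (1 + ζ ^ 2) ^ ((n : ℝ) / 2)) := by
  have hε0 : 0 < ε := hε
  have hsq : 0 < √q := Real.sqrt_pos.2 hq0
  have hsq2 : √q ^ 2 = q := Real.sq_sqrt hq0.le
  have hc0 : 0 ≤ d / √q := div_nonneg hd0 hsq.le
  have ha : -1 / ε ≤ d / √q :=
    (div_nonpos_of_nonpos_of_nonneg (by norm_num) hε0.le).trans hc0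
  have hγ : (√q)⁻¹ ^ 2 * ‖pb‖ ^ 2 = (√q)⁻¹ ^ 2 - 1 := by
    rw [inv_pow, hsq2]
    field_simp
    linarith
  have hp1 : ‖pb‖ ≤ 1 := by nlinarith [norm_nonneg pb]
  have hslice : ‖pb‖ * √(1 + (1 / ε) ^ 2) ≤ 1 / ε + d := by
    have h1 : √(1 - q) = ‖pb‖ := by
      rw [hq, sub_sub_cancel, Real.sqrt_sq (norm_nonneg _)]
    have h2 : √(1 + ε ^ 2) = ε * √(1 + (1 / ε) ^ 2) := by
      rw [← Real.sqrt_sq hε0.le, ← Real.sqrt_mul (sq_nonneg ε), Real.sqrt_sq hε0.le]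
      congr 1
      field_simp
      ring
    rw [h1, h2] at hεd
    have h3 : ε * (‖pb‖ * √(1 + (1 / ε) ^ 2)) ≤ ε * (1 / ε + d) := by
      rw [mul_add, mul_one_div_cancel hε0.ne']
      linarith
    exact le_of_mul_le_mul_left h3 hε0
  have hplane : ∀ w : EuclideanSpace ℝ (Fin n) × ℝ,
      (√q)⁻¹ * (w.2 - ⟪pb, w.1⟫) ≤ d / √q ↔ w.2 ≤ zb + ⟪pb, w.1 - xb⟫ := fun w => by
    rw [inv_mul_eq_div, div_le_div_iff_of_pos_right hsq, inner_sub_right, hd]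
    constructor <;> intro h <;> linarith
  have hbelow : ∀ w : EuclideanSpace ℝ (Fin n) × ℝ, ‖w.1‖ ^ 2 ≤ 1 + w.2 ^ 2 →
      d / √q < (√q)⁻¹ * (w.2 - ⟪pb, w.1⟫) → -1 / ε ≤ w.2 := fun w hw h => by
    by_contra! hlt
    refine h.not_ge ?_
    rw [inv_mul_eq_div, div_le_div_iff_of_pos_right hsq]
    exact sub_inner_le_of_lt_neg hp1 (by positivity) hslice hw (by rwa [← neg_div])
  have hcut : MeasurableSet {w : EuclideanSpace ℝ (Fin n) × ℝ | w.2 ≤ d / √q} :=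
    measurableSet_le measurable_snd measurable_const
  have htilt : MeasurableSet {w : EuclideanSpace ℝ (Fin n) × ℝ |
      (√q)⁻¹ * (w.2 - ⟪pb, w.1⟫) ≤ d / √q} :=
    (isClosed_le (by fun_prop) continuous_const).measurableSet
  rw [← volume_hyperboloid_slab n hn ha, ← measure_inter_add_sdiff _ hcut,
    ← measure_inter_add_sdiff {w : EuclideanSpace ℝ (Fin n) × ℝ |
      ‖w.1‖ ^ 2 ≤ 1 + w.2 ^ 2 ∧ -1 / ε ≤ w.2 ∧ w.2 ≤ d / √q} htilt]
  congr 1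
  · congr 1
    ext w
    simp only [Set.mem_inter_iff, Set.mem_ofPred_eq, hplane]
    tauto
  · convert volume_above_lower_eq_below_upper pb (inv_pos.2 hsq) hγ (d / √q) using 2
    · ext w
      simp only [Set.mem_sdiff, Set.mem_ofPred_eq, hplane, not_le]
      constructor
      · rintro ⟨⟨-, h1, h2⟩, h3⟩
        exact ⟨h1, h3, h2⟩
      · rintro ⟨h1, h2, h3⟩
        exact ⟨⟨ha.trans h2.le, h1, h3⟩, h2⟩
    · ext w
      simp only [Set.mem_sdiff, Set.mem_ofPred_eq, not_le]
      constructor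
      · rintro ⟨⟨h1, -, h2⟩, h3⟩
        exact ⟨h1, h2, h3⟩
      · rintro ⟨h1, h2, h3⟩
        exact ⟨⟨h1, hbelow w h1 h3, h2⟩, h3⟩
end

section
/- Let n ≥ 1, k > 0 and ε > 0, and set φ(ε) = (k/ε)(k + √((1 + ε²)(1 + k²))). For every x̄ ∈ ℝⁿ such that z̄ := √(k² + |x̄|²) satisfies z̄ ≤ φ(ε), the hyperplane tangent at (x̄, z̄) to the upper sheet of the two-sheeted hyperboloid z² − |x|² = k², namely z = (⟨x̄, x⟩ + k²)/z̄, cuts off from the truncated solid one-sheeted hyperboloid H_ε = {(x,z) ∈ ℝⁿ × ℝ : z ≥ −1/ε, |x|² ≤ 1 + z²} a compact set of volume independent of x̄: the (n+1)-dimensional Lebesgue measure of {(x,z) : z ≥ −1/ε, |x|² ≤ 1 + z², z ≤ (⟨x̄, x⟩ + k²)/z̄} equals (π^{n/2} / Γ(n/2 + 1)) · ∫_{−1/ε}^{k} (1 + ζ²)^{n/2} dζ. -/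
open MeasureTheory
open scoped RealInnerProductSpace

section LorentzBoost

variable {E : Type*} [NormedAddCommGroup E] [InnerProductSpace ℝ E]

/-- The Lorentz boost of `E × ℝ` with spatial velocity `u` and time dilation `γ`, sending the unit
vector `(u, γ)` to the vertical axis when `γ ^ 2 = 1 + ‖u‖ ^ 2`. -/
noncomputable def lorentzBoost (u : E) (γ : ℝ) : E × ℝ →ₗ[ℝ] E × ℝ where
  toFun w := (w.1 + (⟪u, w.1⟫ / (1 + γ) - w.2) • u, γ * w.2 - ⟪u, w.1⟫)
  map_add' v w := by
    ext
    · simp only [Prod.fst_add, Prod.snd_add, inner_add_right]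
      module
    · simp only [Prod.fst_add, Prod.snd_add, inner_add_right]
      ring
  map_smul' c w := by
    ext
    · simp only [Prod.smul_fst, Prod.smul_snd, inner_smul_right, smul_eq_mul, RingHom.id_apply]
      module
    · simp only [Prod.smul_fst, Prod.smul_snd, inner_smul_right, smul_eq_mul, RingHom.id_apply]
      ring

theorem lorentzBoost_apply (u : E) (γ : ℝ) (w : E × ℝ) :
    lorentzBoost u γ w = (w.1 + (⟪u, w.1⟫ / (1 + γ) - w.2) • u, γ * w.2 - ⟪u, w.1⟫) := rfl

/-- The reflection of `E × ℝ` in `E × {0}`. -/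
def timeReflection (E : Type*) [NormedAddCommGroup E] [InnerProductSpace ℝ E] :
    E × ℝ →ₗ[ℝ] E × ℝ :=
  LinearMap.prodMap LinearMap.id (-LinearMap.id)

theorem timeReflection_apply (w : E × ℝ) : timeReflection E w = (w.1, -w.2) := rfl

theorem timeReflection_comp_self : timeReflection E ∘ₗ timeReflection E = LinearMap.id := by
  ext <;> simp [timeReflection_apply]

theorem timeReflection_comp_lorentzBoost_sq {u : E} {γ : ℝ} (hγ : 0 < γ)
    (h : γ ^ 2 = 1 + ‖u‖ ^ 2) :
    (timeReflection E ∘ₗ lorentzBoost u γ) ∘ₗ (timeReflection E ∘ₗ lorentzBoost u γ) =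
      LinearMap.id := by
  have hne : 1 + γ ≠ 0 := by positivity
  have hu : ‖u‖ ^ 2 = γ ^ 2 - 1 := by linarith
  refine LinearMap.ext fun w => Prod.ext ?_ ?_
  · simp only [LinearMap.comp_apply, timeReflection_apply, lorentzBoost_apply, inner_add_right,
      inner_smul_right, real_inner_self_eq_norm_sq, hu, LinearMap.id_apply]
    rw [add_assoc, ← add_smul, add_eq_left]
    convert zero_smul ℝ u using 2
    field_simp
    ring
  · simp only [LinearMap.comp_apply, timeReflection_apply, lorentzBoost_apply, inner_add_right,
      inner_smul_right, real_inner_self_eq_norm_sq, hu, LinearMap.id_apply]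
    field_simp
    ring

theorem abs_det_lorentzBoost {u : E} {γ : ℝ} (hγ : 0 < γ) (h : γ ^ 2 = 1 + ‖u‖ ^ 2) :
    |LinearMap.det (lorentzBoost u γ)| = 1 := by
  have h₁ := congrArg LinearMap.det (timeReflection_comp_self (E := E))
  have h₂ := congrArg LinearMap.det (timeReflection_comp_lorentzBoost_sq hγ h)
  simp only [LinearMap.det_comp, LinearMap.det_id] at h₁ h₂
  refine (sq_eq_sq₀ (abs_nonneg _) zero_le_one).1 ?_
  rw [sq_abs]
  linear_combination h₂ - LinearMap.det (lorentzBoost u γ) ^ 2 * h₁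

/-- A Lorentz boost preserves the Minkowski quadratic form. -/
theorem lorentzBoost_norm_sq_sub_sq {u : E} {γ : ℝ} (hγ : 0 < γ) (h : γ ^ 2 = 1 + ‖u‖ ^ 2)
    (w : E × ℝ) :
    ‖(lorentzBoost u γ w).1‖ ^ 2 - (lorentzBoost u γ w).2 ^ 2 = ‖w.1‖ ^ 2 - w.2 ^ 2 := by
  have hne : 1 + γ ≠ 0 := by positivity
  have hu : ‖u‖ ^ 2 = γ ^ 2 - 1 := by linarith
  simp only [lorentzBoost_apply]
  rw [norm_add_sq_real, norm_smul, mul_pow, hu, inner_smul_right, real_inner_comm w.1 u,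
    Real.norm_eq_abs, sq_abs]
  field_simp
  ring

/-- The solid one-sheeted hyperboloid in `E × ℝ` with unit semiaxes. -/
def solidHyperboloid (E : Type*) [NormedAddCommGroup E] : Set (E × ℝ) := {w | ‖w.1‖ ^ 2 ≤ 1 + w.2 ^ 2}

theorem mem_solidHyperboloid {E : Type*} [NormedAddCommGroup E] {w : E × ℝ} :
    w ∈ solidHyperboloid E ↔ ‖w.1‖ ^ 2 ≤ 1 + w.2 ^ 2 := Iff.rfl

theorem lorentzBoost_preimage_solidHyperboloid {u : E} {γ : ℝ} (hγ : 0 < γ)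
    (h : γ ^ 2 = 1 + ‖u‖ ^ 2) :
    lorentzBoost u γ ⁻¹' solidHyperboloid E = solidHyperboloid E := by
  ext w
  have := lorentzBoost_norm_sq_sub_sq hγ h w
  simp only [Set.mem_preimage, mem_solidHyperboloid]
  constructor <;> intro <;> linarith

theorem neg_preimage_solidHyperboloid {E : Type*} [NormedAddCommGroup E] :
    (fun w => -w) ⁻¹' solidHyperboloid E = solidHyperboloid E := by
  ext w
  simp [mem_solidHyperboloid]

/-- A sufficient condition on the height of a point in the lower half of the solid hyperboloid for
it to lie below a given spacelike hyperplane. -/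
theorem lorentzBoost_snd_le {u : E} {γ : ℝ} (hγ : 0 < γ) (h : γ ^ 2 = 1 + ‖u‖ ^ 2) {c : ℝ}
    (hc : 0 ≤ c) {w : E × ℝ} (hw : w ∈ solidHyperboloid E) (hz : w.2 ≤ 0)
    (hq : 0 ≤ w.2 ^ 2 - 2 * c * γ * w.2 + c ^ 2 - ‖u‖ ^ 2) :
    (lorentzBoost u γ w).2 ≤ c := by
  have h₁ : -⟪u, w.1⟫ ≤ ‖u‖ * ‖w.1‖ := (neg_le_abs _).trans (abs_real_inner_le_norm u w.1)
  have h₂ : ‖u‖ * ‖w.1‖ ≤ c - γ * w.2 := by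
    refine abs_le_of_sq_le_sq' ?_ (by nlinarith) |>.2
    have := mul_le_mul_of_nonneg_left (mem_solidHyperboloid.1 hw) (sq_nonneg ‖u‖)
    have h₃ : γ ^ 2 * w.2 ^ 2 = (1 + ‖u‖ ^ 2) * w.2 ^ 2 := by rw [h]
    nlinarith
  rw [lorentzBoost_apply]
  dsimp only
  linarith

section Measure

variable [MeasurableSpace E] [BorelSpace E]

theorem measurableSet_solidHyperboloid {E : Type*} [NormedAddCommGroup E] [MeasurableSpace E]
    [BorelSpace E] : MeasurableSet (solidHyperboloid E) :=
  measurableSet_le (by fun_prop) (by fun_prop)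

variable [FiniteDimensional ℝ E]

theorem measurable_lorentzBoost (u : E) (γ : ℝ) : Measurable (lorentzBoost u γ) :=
  (LinearMap.continuous_of_finiteDimensional _).measurable

theorem isAddHaarMeasure_volume_prod_real :
    (volume : Measure (E × ℝ)).IsAddHaarMeasure :=
  Measure.prod.instIsAddHaarMeasure volume volume

theorem measurePreserving_lorentzBoost {u : E} {γ : ℝ} (hγ : 0 < γ) (h : γ ^ 2 = 1 + ‖u‖ ^ 2) :
    MeasurePreserving (lorentzBoost u γ)
      (volume.restrict (solidHyperboloid E)) (volume.restrict (solidHyperboloid E)) := by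
  have hdet := abs_det_lorentzBoost hγ h
  have := isAddHaarMeasure_volume_prod_real (E := E)
  have hmp : MeasurePreserving (lorentzBoost u γ) (volume : Measure (E × ℝ)) volume := by
    refine ⟨measurable_lorentzBoost u γ, ?_⟩
    rw [Measure.map_linearMap_addHaar_eq_smul_addHaar _ (by intro h₀; simp [h₀] at hdet), abs_inv,
      hdet]
    simp
  have := hmp.restrict_preimage (measurableSet_solidHyperboloid (E := E))
  rwa [lorentzBoost_preimage_solidHyperboloid hγ h] at this

theorem measurePreserving_neg_solidHyperboloid :
    MeasurePreserving (fun w : E × ℝ => -w)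
      (volume.restrict (solidHyperboloid E)) (volume.restrict (solidHyperboloid E)) := by
  have := isAddHaarMeasure_volume_prod_real (E := E)
  have := (Measure.measurePreserving_neg (volume : Measure (E × ℝ))).restrict_preimage
    (measurableSet_solidHyperboloid (E := E))
  rwa [show (Neg.neg : E × ℝ → E × ℝ) = fun w => -w from rfl,
    neg_preimage_solidHyperboloid] at this

theorem ae_snd_ne_zero_solidHyperboloid :
    ∀ᵐ w ∂(volume.restrict (solidHyperboloid E) : Measure (E × ℝ)), w.2 ≠ 0 := by
  refine ae_restrict_of_ae ?_
  rw [ae_iff]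
  have : {w : E × ℝ | ¬ w.2 ≠ 0} = Set.univ ×ˢ {0} := by ext; simp
  rw [this, Measure.volume_eq_prod, Measure.prod_prod]
  simp

theorem ae_lorentzBoost_snd_ne_zero {u : E} {γ : ℝ} (hγ : 0 < γ) (h : γ ^ 2 = 1 + ‖u‖ ^ 2) :
    ∀ᵐ w ∂(volume.restrict (solidHyperboloid E) : Measure (E × ℝ)),
      (lorentzBoost u γ w).2 ≠ 0 :=
  (measurePreserving_lorentzBoost hγ h).quasiMeasurePreserving.ae
    ae_snd_ne_zero_solidHyperboloid

/-- Replacing the horizontal cap `z ≤ k` of the solid hyperboloid by a tangent hyperplane of the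
two-sheeted hyperboloid of radius `k` does not change the volume above `z = a`. -/
theorem volume_solidHyperboloid_lorentzBoost_snd_le {u : E} {γ : ℝ} (hγ : 0 < γ)
    (h : γ ^ 2 = 1 + ‖u‖ ^ 2) {a k : ℝ} (ha : a ≤ 0) (hk : 0 ≤ k)
    (hfin : ∀ b, volume.restrict (solidHyperboloid E) {w : E × ℝ | b ≤ w.2 ∧ w.2 < a} ≠ ⊤)
    (hcut : ∀ w ∈ solidHyperboloid E, w.2 < a → (lorentzBoost u γ w).2 ≤ k) :
    volume.restrict (solidHyperboloid E) {w : E × ℝ | a ≤ w.2 ∧ (lorentzBoost u γ w).2 ≤ k} =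
      volume.restrict (solidHyperboloid E) {w : E × ℝ | a ≤ w.2 ∧ w.2 ≤ k} := by
  set ν : Measure (E × ℝ) := volume.restrict (solidHyperboloid E)
  set f : E × ℝ → ℝ := fun w => (lorentzBoost u γ w).2 with hf
  have mf : Measurable f := measurable_snd.comp (measurable_lorentzBoost u γ)
  have mz : Measurable (fun w : E × ℝ => w.2) := measurable_snd
  have hmem : ∀ᵐ w ∂ν, w ∈ solidHyperboloid E := ae_restrict_mem measurableSet_solidHyperboloid
  set b : ℝ := min a (-‖u‖)
  have hba : b ≤ a := min_le_left _ _
  have hdeep : ∀ w ∈ solidHyperboloid E, w.2 < b → f w ≤ 0 := fun w hw hwb => by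
    have h₁ : w.2 ≤ -‖u‖ := hwb.le.trans (min_le_right _ _)
    have h₀ := norm_nonneg u
    exact lorentzBoost_snd_le hγ h le_rfl hw (by linarith) (by nlinarith)
  have split : ∀ {s : Set (E × ℝ)} (t : Set (E × ℝ)), MeasurableSet t →
      ν s = ν (s ∩ t) + ν (s \ t) := fun t ht => (measure_inter_add_sdiff _ ht).symm
  have e₁ : ν {w | b ≤ w.2 ∧ f w ≤ k} = ν {w | b ≤ w.2 ∧ w.2 < a} + ν {w | a ≤ w.2 ∧ f w ≤ k} := by
    rw [split {w | w.2 < a} (measurableSet_lt mz measurable_const)]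
    congr 1 <;> refine measure_congr ?_ <;> filter_upwards [hmem] with w hw <;>
      refine propext ?_
    · exact ⟨fun H => ⟨H.1.1, H.2⟩, fun H => ⟨⟨H.1, hcut w hw H.2⟩, H.2⟩⟩
    · exact ⟨fun H => ⟨not_lt.1 H.2, H.1.2⟩, fun H => ⟨⟨hba.trans H.1, H.2⟩, not_lt.2 H.1⟩⟩
  have e₂ : ν {w | b ≤ w.2 ∧ f w ≤ k} = ν {w | b ≤ w.2 ∧ f w ≤ 0} + ν {w | 0 < f w ∧ f w ≤ k} := by
    rw [split {w | f w ≤ 0} (measurableSet_le mf measurable_const)]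
    congr 1 <;> refine measure_congr ?_ <;> filter_upwards [hmem] with w hw <;>
      refine propext ?_
    · exact ⟨fun H => ⟨H.1.1, H.2⟩, fun H => ⟨⟨H.1, H.2.trans hk⟩, H.2⟩⟩
    · refine ⟨fun H => ⟨not_le.1 H.2, H.1.2⟩, fun H => ⟨⟨?_, H.2⟩, not_le.2 H.1⟩⟩
      by_contra! hlt
      exact (hdeep w hw hlt).not_gt H.1
  have e₃ : ν {w | 0 < f w ∧ f w ≤ k} = ν {w | 0 < w.2 ∧ w.2 ≤ k} :=
    (measurePreserving_lorentzBoost hγ h).measure_preimage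
      ((measurableSet_lt measurable_const mz).inter
        (measurableSet_le mz measurable_const)).nullMeasurableSet
  have e₄ : ν {w | b ≤ w.2 ∧ f w ≤ 0} =
      ν {w | (b ≤ w.2 ∧ w.2 ≤ 0) ∧ f w ≤ 0} + ν {w | 0 < w.2 ∧ f w ≤ 0} := by
    rw [split {w | w.2 ≤ 0} (measurableSet_le mz measurable_const)]
    congr 2 <;> ext w
    · exact ⟨fun H => ⟨⟨H.1.1, H.2⟩, H.1.2⟩, fun H => ⟨⟨H.1.1, H.2⟩, H.1.2⟩⟩
    · exact ⟨fun H => ⟨not_le.1 H.2, H.1.2⟩,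
        fun H => ⟨⟨(hba.trans ha).trans H.1.le, H.2⟩, not_le.2 H.1⟩⟩
  have e₅ : ν {w | b ≤ w.2 ∧ w.2 ≤ 0} =
      ν {w | (b ≤ w.2 ∧ w.2 ≤ 0) ∧ f w ≤ 0} + ν {w | w.2 ≤ 0 ∧ 0 < f w} := by
    rw [split {w | f w ≤ 0} (measurableSet_le mf measurable_const)]
    congr 1
    refine measure_congr ?_
    filter_upwards [hmem] with w hw
    refine propext ⟨fun H => ⟨H.1.2, not_le.1 H.2⟩, fun H => ⟨⟨?_, H.1⟩, not_le.2 H.2⟩⟩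
    by_contra! hlt
    exact (hdeep w hw hlt).not_gt H.2
  have e₆ : ν {w | 0 < w.2 ∧ f w ≤ 0} = ν {w | w.2 ≤ 0 ∧ 0 < f w} := by
    refine (measurePreserving_neg_solidHyperboloid.measure_preimage
      ((measurableSet_lt measurable_const mz).inter
        (measurableSet_le mf measurable_const)).nullMeasurableSet).symm.trans ?_
    refine measure_congr ?_
    filter_upwards [ae_snd_ne_zero_solidHyperboloid, ae_lorentzBoost_snd_ne_zero hγ h]
      with w hw₁ hw₂
    have hneg : f (-w) = -f w := by simp [hf]
    have hw₂' : f w ≠ 0 := hw₂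
    refine propext ?_
    change (0 < (-w).2 ∧ f (-w) ≤ 0) ↔ (w.2 ≤ 0 ∧ 0 < f w)
    rw [hneg, Prod.snd_neg, neg_pos, neg_nonpos]
    exact ⟨fun H => ⟨H.1.le, lt_of_le_of_ne H.2 hw₂'.symm⟩,
      fun H => ⟨lt_of_le_of_ne H.1 hw₁, H.2.le⟩⟩
  have e₇ : ν {w | b ≤ w.2 ∧ w.2 ≤ k} =
      ν {w | b ≤ w.2 ∧ w.2 ≤ 0} + ν {w | 0 < w.2 ∧ w.2 ≤ k} := by
    rw [split {w | w.2 ≤ 0} (measurableSet_le mz measurable_const)]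
    congr 2 <;> ext w
    · exact ⟨fun H => ⟨H.1.1, H.2⟩, fun H => ⟨⟨H.1, H.2.trans hk⟩, H.2⟩⟩
    · exact ⟨fun H => ⟨not_le.1 H.2, H.1.2⟩,
        fun H => ⟨⟨(hba.trans ha).trans H.1.le, H.2⟩, not_le.2 H.1⟩⟩
  have e₈ : ν {w | b ≤ w.2 ∧ w.2 ≤ k} =
      ν {w | b ≤ w.2 ∧ w.2 < a} + ν {w | a ≤ w.2 ∧ w.2 ≤ k} := by
    rw [split {w | w.2 < a} (measurableSet_lt mz measurable_const)]
    congr 2 <;> ext w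
    · exact ⟨fun H => ⟨H.1.1, H.2⟩, fun H => ⟨⟨H.1, H.2.le.trans (ha.trans hk)⟩, H.2⟩⟩
    · exact ⟨fun H => ⟨not_lt.1 H.2, H.1.2⟩, fun H => ⟨⟨hba.trans H.1, H.2⟩, not_lt.2 H.1⟩⟩
  refine (ENNReal.add_right_inj (hfin b)).1 ?_
  rw [← e₁, ← e₈, e₂, e₃, e₄, e₆, ← e₅, ← e₇]

end Measure

end LorentzBoost

/-- The volume of a slab of the solid hyperboloid between two horizontal hyperplanes. -/
theorem volume_solidHyperboloid_slab {n : ℕ} (hn : 1 ≤ n) {a b : ℝ} (hab : a ≤ b) :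
    volume.restrict (solidHyperboloid (EuclideanSpace ℝ (Fin n)))
        {w : EuclideanSpace ℝ (Fin n) × ℝ | a ≤ w.2 ∧ w.2 ≤ b} =
      ENNReal.ofReal (Real.pi ^ ((n : ℝ) / 2) / Real.Gamma ((n : ℝ) / 2 + 1) *
        ∫ ζ in a..b, (1 + ζ ^ 2) ^ ((n : ℝ) / 2)) := by
  have : Nonempty (Fin n) := ⟨⟨0, hn⟩⟩
  have hcont : Continuous fun ζ : ℝ => Real.pi ^ ((n : ℝ) / 2) / Real.Gamma ((n : ℝ) / 2 + 1) *
      (1 + ζ ^ 2) ^ ((n : ℝ) / 2) :=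
    continuous_const.mul ((by fun_prop : Continuous fun ζ : ℝ => 1 + ζ ^ 2).rpow_const
      fun ζ => Or.inr (by positivity))
  have hΓ : 0 < Real.Gamma ((n : ℝ) / 2 + 1) := Real.Gamma_pos_of_pos (by positivity)
  have hsq : ∀ {x : ℝ}, 0 ≤ x → Real.sqrt x ^ n = x ^ ((n : ℝ) / 2) := fun {x} hx => by
    rw [Real.sqrt_eq_rpow, ← Real.rpow_natCast, ← Real.rpow_mul hx]
    congr 1
    ring
  have hS : MeasurableSet {w : EuclideanSpace ℝ (Fin n) × ℝ | a ≤ w.2 ∧ w.2 ≤ b} :=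
    (measurableSet_le measurable_const measurable_snd).inter
      (measurableSet_le measurable_snd measurable_const)
  rw [Measure.restrict_apply hS, Measure.volume_eq_prod,
    Measure.prod_apply_symm (hS.inter measurableSet_solidHyperboloid),
    ← intervalIntegral.integral_const_mul, intervalIntegral.integral_of_le hab,
    ← integral_Icc_eq_integral_Ioc,
    ofReal_integral_eq_lintegral_ofReal (hcont.integrableOn_Icc)
      (Filter.Eventually.of_forall fun ζ => by positivity),
    ← lintegral_indicator measurableSet_Icc]
  refine lintegral_congr fun ζ => ?_
  by_cases hζ : ζ ∈ Set.Icc a b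
  · have hball : (fun x => (x, ζ)) ⁻¹' ({w : EuclideanSpace ℝ (Fin n) × ℝ | a ≤ w.2 ∧ w.2 ≤ b} ∩
        solidHyperboloid _) = Metric.closedBall 0 (Real.sqrt (1 + ζ ^ 2)) := by
      ext x
      rw [mem_closedBall_zero_iff, Real.le_sqrt (norm_nonneg x) (by positivity)]
      exact ⟨fun H => H.2, fun H => ⟨hζ, H⟩⟩
    rw [hball, Set.indicator_of_mem hζ, EuclideanSpace.volume_closedBall, Fintype.card_fin,
      ← ENNReal.ofReal_pow (Real.sqrt_nonneg _), ← ENNReal.ofReal_mul (by positivity),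
      hsq (by positivity), hsq Real.pi_pos.le, mul_comm]
  · have hempty : (fun x => (x, ζ)) ⁻¹' ({w : EuclideanSpace ℝ (Fin n) × ℝ | a ≤ w.2 ∧ w.2 ≤ b} ∩
        solidHyperboloid _) = ∅ := by
      ext x
      exact ⟨fun H => hζ H.1, fun H => H.elim⟩
    rw [hempty, Set.indicator_of_notMem hζ, measure_empty]

theorem stmt_11 (n : ℕ) (hn : 1 ≤ n) (k ε : ℝ) (hk : k > 0) (hε : ε > 0)
    (xb : EuclideanSpace ℝ (Fin n)) (zb : ℝ)
    (hzb : zb = Real.sqrt (k ^ 2 + ‖xb‖ ^ 2))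
    (htrunc : zb ≤ (k / ε) * (k + Real.sqrt ((1 + ε ^ 2) * (1 + k ^ 2)))) :
    volume {w : EuclideanSpace ℝ (Fin n) × ℝ |
        -1 / ε ≤ w.2 ∧ ‖w.1‖ ^ 2 ≤ 1 + w.2 ^ 2 ∧ w.2 ≤ (⟪xb, w.1⟫ + k ^ 2) / zb} =
      ENNReal.ofReal (Real.pi ^ ((n : ℝ) / 2) / Real.Gamma ((n : ℝ) / 2 + 1) *
        ∫ ζ in (-1 / ε)..k, (1 + ζ ^ 2) ^ ((n : ℝ) / 2)) := by
  have hzpos : 0 < zb := hzb ▸ Real.sqrt_pos.2 (by positivity)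
  have hzsq : zb ^ 2 = k ^ 2 + ‖xb‖ ^ 2 := by rw [hzb, Real.sq_sqrt (by positivity)]
  set u : EuclideanSpace ℝ (Fin n) := k⁻¹ • xb with hu
  set γ : ℝ := zb / k with hγdef
  have hγ : 0 < γ := div_pos hzpos hk
  have hnu : ‖u‖ ^ 2 = ‖xb‖ ^ 2 / k ^ 2 := by
    rw [hu, norm_smul, mul_pow, Real.norm_eq_abs, sq_abs]
    field_simp
  have h : γ ^ 2 = 1 + ‖u‖ ^ 2 := by
    rw [hnu, hγdef, div_pow, hzsq]
    field_simp
  have ha : -1 / ε ≤ 0 := div_nonpos_of_nonpos_of_nonneg (by norm_num) hε.le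
  have hq : 0 ≤ 1 + 2 * k * γ * ε + ε ^ 2 * (k ^ 2 - ‖u‖ ^ 2) := by
    have h₁ : ε * γ - k ≤ Real.sqrt ((1 + ε ^ 2) * (1 + k ^ 2)) := by
      have : γ ≤ (k + Real.sqrt ((1 + ε ^ 2) * (1 + k ^ 2))) / ε := by
        rw [hγdef, div_le_iff₀ hk]
        exact htrunc.trans_eq (by ring)
      rw [le_div_iff₀ hε] at this
      linarith
    have h₂ : (ε * γ - k) ^ 2 ≤ (1 + ε ^ 2) * (1 + k ^ 2) ∨ ε * γ < k := by
      refine (le_or_gt k (ε * γ)).imp_left fun hle => ?_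
      exact (Real.le_sqrt (by linarith) (by positivity)).1 h₁
    have h₃ : ‖u‖ ^ 2 = γ ^ 2 - 1 := by linarith
    rw [h₃]
    have h₄ : 0 < ε * γ := by positivity
    rcases h₂ with h₂ | h₂
    · nlinarith
    · nlinarith [mul_pos h₄ (sub_pos.2 h₂), mul_pos h₄ hk, sq_nonneg (ε * k), sq_nonneg ε]
  have hcut : ∀ w ∈ solidHyperboloid (EuclideanSpace ℝ (Fin n)), w.2 < -1 / ε →
      (lorentzBoost u γ w).2 ≤ k := fun w hw hlt => by
    refine lorentzBoost_snd_le hγ h hk.le hw (hlt.le.trans ha) ?_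
    have h₁ : 1 < -w.2 * ε := by
      rw [lt_div_iff₀ hε] at hlt
      linarith
    have h₂ : 0 < k * γ * ε := by positivity
    have h₃ : 0 ≤ ε ^ 2 * (w.2 ^ 2 - 2 * k * γ * w.2 + k ^ 2 - ‖u‖ ^ 2) := by
      nlinarith [mul_pos h₂ (sub_pos.2 h₁)]
    exact nonneg_of_mul_nonneg_right h₃ (by positivity)
  have hfin : ∀ b, volume.restrict (solidHyperboloid (EuclideanSpace ℝ (Fin n)))
      {w : EuclideanSpace ℝ (Fin n) × ℝ | b ≤ w.2 ∧ w.2 < -1 / ε} ≠ ⊤ := fun b => by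
    refine ne_top_of_le_ne_top ?_ (measure_mono (t := {w | min b (-1 / ε) ≤ w.2 ∧ w.2 ≤ -1 / ε})
      fun w hw => ⟨(min_le_left _ _).trans hw.1, hw.2.le⟩)
    rw [volume_solidHyperboloid_slab hn (min_le_right _ _)]
    exact ENNReal.ofReal_ne_top
  rw [← volume_solidHyperboloid_slab hn (ha.trans hk.le),
    ← volume_solidHyperboloid_lorentzBoost_snd_le hγ h ha hk.le hfin hcut,
    Measure.restrict_apply' measurableSet_solidHyperboloid]
  congr 1
  ext w
  have hiff : w.2 ≤ (⟪xb, w.1⟫ + k ^ 2) / zb ↔ (lorentzBoost u γ w).2 ≤ k := by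
    rw [lorentzBoost_apply, le_div_iff₀ hzpos, hu, hγdef, real_inner_smul_left,
      ← mul_le_mul_iff_right₀ hk (b := _ - _)]
    have : k * (zb / k * w.2 - k⁻¹ * ⟪xb, w.1⟫) = zb * w.2 - ⟪xb, w.1⟫ := by field_simp
    rw [this]
    constructor <;> intro <;> nlinarith
  simp only [Set.mem_ofPred_eq, Set.mem_inter_iff, mem_solidHyperboloid, hiff]
  tauto
end
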